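/- arXiv:math/0406262 — 3 statements merged into one kernel-verified Lean document; each statement's English description precedes it below -/
import Mathlib

section
/- Let g ≥ 1 and let Z be a symmetric g×g complex matrix whose imaginary part is positive definite. Then for all x, y ∈ ℂ^g the multiplication formula holds: θ(Z, x) · θ(Z, y) = ∑_{a ∈ {0,1}^g} (∑_{m ∈ ℤ^g} exp(2π i (m + a/2)ᵀ Z (m + a/2) + 2π i (m + a/2)ᵀ (x + y))) · (∑_{n ∈ ℤ^g} exp(2π i (n + a/2)ᵀ Z (n + a/2) + 2π i (n + a/2)ᵀ (x − y))), where the outer sum runs over the 2^g vectors a with entries in {0,1}. -/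
open scoped Real
open Complex Matrix

/-- The Siegel theta series `θ(Z,v) = ∑_{t ∈ ℤ^g} exp(π i tᵀ Z t + 2π i tᵀ v)`. -/
noncomputable def siegelTheta (g : ℕ) (Z : Matrix (Fin g) (Fin g) ℂ)
    (v : Fin g → ℂ) : ℂ :=
  ∑' t : Fin g → ℤ,
    Complex.exp (↑π * Complex.I *
        ((fun i => (t i : ℂ)) ⬝ᵥ Z.mulVec (fun i => (t i : ℂ))) +
      2 * ↑π * Complex.I * ((fun i => (t i : ℂ)) ⬝ᵥ v))

/-- A finite product of nonnegative summable families is summable over the product index. -/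
theorem summable_prod_pi_of_nonneg {ι κ : Type*} [Fintype ι] {f : ι → κ → ℝ}
    (h0 : ∀ i k, 0 ≤ f i k) (hf : ∀ i, Summable (f i)) :
    Summable fun t : ι → κ => ∏ i, f i (t i) := by
  classical
  refine summable_of_sum_le (c := ∏ i, ∑' k, f i k)
    (fun t => Finset.prod_nonneg fun i _ => h0 i (t i)) fun s => ?_
  calc ∑ t ∈ s, ∏ i, f i (t i)
      ≤ ∑ t ∈ Fintype.piFinset fun i => s.image fun t => t i, ∏ i, f i (t i) :=
        Finset.sum_le_sum_of_subset_of_nonneg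
          (fun t ht => Fintype.mem_piFinset.2 fun i => Finset.mem_image_of_mem _ ht)
          fun t _ _ => Finset.prod_nonneg fun i _ => h0 i (t i)
    _ = ∏ i, ∑ k ∈ s.image fun t => t i, f i k := (Finset.prod_univ_sum _ _).symm
    _ ≤ ∏ i, ∑' k, f i k :=
        Finset.prod_le_prod (fun i _ => Finset.sum_nonneg fun k _ => h0 i k)
          fun i _ => (hf i).sum_le_tsum _ fun k _ => h0 i k

/-- A positive definite real quadratic form dominates a positive multiple of the sum of squares. -/
theorem Matrix.PosDef.exists_pos_mul_sum_sq_le {ι : Type*} [Fintype ι] {Y : Matrix ι ι ℝ}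
    (hY : Y.PosDef) : ∃ c : ℝ, 0 < c ∧ ∀ x : ι → ℝ, c * ∑ i, x i ^ 2 ≤ x ⬝ᵥ Y *ᵥ x := by
  rcases isEmpty_or_nonempty ι with hι | hι
  · exact ⟨1, one_pos, fun x => by simp [dotProduct]⟩
  have hcont : Continuous fun x : ι → ℝ => x ⬝ᵥ Y *ᵥ x := by fun_prop
  obtain ⟨x₀, hx₀, hmin⟩ := (isCompact_sphere (0 : ι → ℝ) 1).exists_isMinOn
    (NormedSpace.sphere_nonempty.2 zero_le_one) hcont.continuousOn
  have hx₀' : x₀ ≠ 0 := by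
    rintro rfl
    simp at hx₀
  have hpos : 0 < x₀ ⬝ᵥ Y *ᵥ x₀ := by simpa using hY.dotProduct_mulVec_pos hx₀'
  have hcard : (0 : ℝ) < Fintype.card ι := by exact_mod_cast Fintype.card_pos
  refine ⟨(x₀ ⬝ᵥ Y *ᵥ x₀) / Fintype.card ι, div_pos hpos hcard, fun x => ?_⟩
  rcases eq_or_ne x 0 with rfl | hx
  · simp
  have hnorm : 0 < ‖x‖ := norm_pos_iff.2 hx
  have hscaled : x₀ ⬝ᵥ Y *ᵥ x₀ ≤ (‖x‖⁻¹ • x) ⬝ᵥ Y *ᵥ (‖x‖⁻¹ • x) :=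
    hmin (by simp [norm_smul, hnorm.ne'])
  have hsum : ∑ i, x i ^ 2 ≤ Fintype.card ι * ‖x‖ ^ 2 := by
    simpa using Finset.sum_le_card_nsmul Finset.univ (fun i => x i ^ 2) (‖x‖ ^ 2)
      fun i _ => sq_le_sq.2 (by simpa using norm_le_pi_norm x i)
  rw [mulVec_smul, smul_dotProduct, dotProduct_smul, smul_eq_mul, smul_eq_mul, ← mul_assoc,
    ← mul_inv, inv_mul_eq_div, le_div_iff₀ (by positivity)] at hscaled
  calc (x₀ ⬝ᵥ Y *ᵥ x₀) / Fintype.card ι * ∑ i, x i ^ 2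
      ≤ (x₀ ⬝ᵥ Y *ᵥ x₀) / Fintype.card ι * (Fintype.card ι * ‖x‖ ^ 2) := by gcongr
    _ = (x₀ ⬝ᵥ Y *ᵥ x₀) * (‖x‖ * ‖x‖) := by field_simp
    _ ≤ _ := hscaled

/-- The Siegel theta series converges absolutely. -/
theorem summable_norm_siegelTheta_term {g : ℕ} {Z : Matrix (Fin g) (Fin g) ℂ}
    (hZ : (Z.map Complex.im).PosDef) (v : Fin g → ℂ) :
    Summable fun t : Fin g → ℤ =>
      ‖Complex.exp (↑π * Complex.I *
          ((fun i => (t i : ℂ)) ⬝ᵥ Z.mulVec (fun i => (t i : ℂ))) +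
        2 * ↑π * Complex.I * ((fun i => (t i : ℂ)) ⬝ᵥ v))‖ := by
  obtain ⟨c, hc, hbound⟩ := hZ.exists_pos_mul_sum_sq_le
  have hone (i : Fin g) : Summable fun n : ℤ => ‖jacobiTheta₂_term n (v i) (c * Complex.I)‖ :=
    ((summable_jacobiTheta₂_term_iff _ _).2 (by simpa using hc)).norm
  refine (summable_prod_pi_of_nonneg (fun _ _ => norm_nonneg _) hone).of_nonneg_of_le
    (fun _ => norm_nonneg _) fun t => ?_
  have hquad : ((fun i => (t i : ℂ)) ⬝ᵥ Z.mulVec (fun i => (t i : ℂ))).im =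
      (fun i => (t i : ℝ)) ⬝ᵥ (Z.map Complex.im) *ᵥ (fun i => (t i : ℝ)) := by
    simp [dotProduct, mulVec, Complex.mul_im]
  have hlin : ((fun i => (t i : ℂ)) ⬝ᵥ v).im = ∑ i, (t i : ℝ) * (v i).im := by
    simp [dotProduct, Complex.mul_im]
  have hre (z w : ℂ) : (↑π * Complex.I * z + 2 * ↑π * Complex.I * w).re =
      -π * z.im - 2 * π * w.im := by
    simp [Complex.mul_re, Complex.mul_im]
    ring
  simp_rw [norm_jacobiTheta₂_term, ← Real.exp_sum, Complex.norm_exp, hre, hquad, hlin]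
  refine Real.exp_le_exp.2 ?_
  have h := mul_le_mul_of_nonneg_left (hbound fun i => (t i : ℝ)) Real.pi_pos.le
  have hsum : ∑ i, (-π * (t i : ℝ) ^ 2 * (c * Complex.I).im - 2 * π * (t i : ℝ) * (v i).im) =
      -(π * (c * ∑ i, (t i : ℝ) ^ 2)) - 2 * π * ∑ i, (t i : ℝ) * (v i).im := by
    simp only [Finset.mul_sum, ← Finset.sum_neg_distrib, ← Finset.sum_sub_distrib]
    refine Finset.sum_congr rfl fun i _ => ?_
    simp
    ring
  rw [hsum]
  linarith

/-- Pairs of integer vectors `(t, s)`, written as `t = m + n + a` and `s = m - n` with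
`a ∈ {0,1}^ι`. -/
def intVecPairEquiv (ι : Type*) :
    (ι → Fin 2) × (ι → ℤ) × (ι → ℤ) ≃ (ι → ℤ) × (ι → ℤ) where
  toFun p := (fun i => p.2.1 i + p.2.2 i + ((p.1 i : ℕ) : ℤ), fun i => p.2.1 i - p.2.2 i)
  invFun q := (fun i => ⟨((q.1 i - q.2 i) % 2).toNat, by omega⟩,
    fun i => q.2 i + (q.1 i - q.2 i) / 2, fun i => (q.1 i - q.2 i) / 2)
  left_inv := by
    rintro ⟨a, m, n⟩
    ext i <;> dsimp only <;> have := (a i).isLt <;> omega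
  right_inv := by
    rintro ⟨t, s⟩
    ext i <;> dsimp only <;> omega

/-- The polarization identity underlying the multiplication formula, with `t = u + w` and
`s = u - w`. -/
theorem quadratic_add_linear_eq_of_add_sub {ι : Type*} [Fintype ι] (Z : Matrix ι ι ℂ)
    (u w x y : ι → ℂ) (k l : ℂ) :
    (k * ((u + w) ⬝ᵥ Z *ᵥ (u + w)) + l * ((u + w) ⬝ᵥ x)) +
        (k * ((u - w) ⬝ᵥ Z *ᵥ (u - w)) + l * ((u - w) ⬝ᵥ y)) =
      (2 * k * (u ⬝ᵥ Z *ᵥ u) + l * (u ⬝ᵥ (x + y))) +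
        (2 * k * (w ⬝ᵥ Z *ᵥ w) + l * (w ⬝ᵥ (x - y))) := by
  simp only [mulVec_add, mulVec_sub, dotProduct_add, dotProduct_sub, add_dotProduct,
    sub_dotProduct]
  ring

theorem siegelTheta_multiplication_formula (g : ℕ) (hg : 1 ≤ g)
    (Z : Matrix (Fin g) (Fin g) ℂ) (hZ : Z.IsSymm)
    (hZim : (Z.map Complex.im).PosDef) (x y : Fin g → ℂ) :
    siegelTheta g Z x * siegelTheta g Z y =
      ∑ a : Fin g → Fin 2,
        (∑' m : Fin g → ℤ,
            Complex.exp (2 * ↑π * Complex.I *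
                ((fun i => (m i : ℂ) + (a i : ℂ) / 2) ⬝ᵥ
                  Z.mulVec (fun i => (m i : ℂ) + (a i : ℂ) / 2)) +
              2 * ↑π * Complex.I *
                ((fun i => (m i : ℂ) + (a i : ℂ) / 2) ⬝ᵥ (x + y)))) *
        (∑' n : Fin g → ℤ,
            Complex.exp (2 * ↑π * Complex.I *
                ((fun i => (n i : ℂ) + (a i : ℂ) / 2) ⬝ᵥ
                  Z.mulVec (fun i => (n i : ℂ) + (a i : ℂ) / 2)) +
              2 * ↑π * Complex.I *
                ((fun i => (n i : ℂ) + (a i : ℂ) / 2) ⬝ᵥ (x - y)))) := by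
  have hsum := summable_mul_of_summable_norm (summable_norm_siegelTheta_term hZim x)
    (summable_norm_siegelTheta_term hZim y)
  have hterm (a : Fin g → Fin 2) (m n : Fin g → ℤ) := by
    have h := quadratic_add_linear_eq_of_add_sub Z (fun i => (m i : ℂ) + (a i : ℂ) / 2)
      (fun i => (n i : ℂ) + (a i : ℂ) / 2) x y (↑π * Complex.I) (2 * ↑π * Complex.I)
    have hadd : (fun i => (m i : ℂ) + (a i : ℂ) / 2) + (fun i => (n i : ℂ) + (a i : ℂ) / 2) =
        fun i => (((intVecPairEquiv (Fin g) (a, m, n)).1 i : ℤ) : ℂ) := by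
      ext i
      simp [intVecPairEquiv]
      ring
    have hsub : (fun i => (m i : ℂ) + (a i : ℂ) / 2) - (fun i => (n i : ℂ) + (a i : ℂ) / 2) =
        fun i => (((intVecPairEquiv (Fin g) (a, m, n)).2 i : ℤ) : ℂ) := by
      ext i
      simp [intVecPairEquiv]
    rw [hadd, hsub, ← mul_assoc 2 (π : ℂ) Complex.I] at h
    have h' := congrArg Complex.exp h
    rw [Complex.exp_add, Complex.exp_add (_ + _) (_ + _)] at h'
    exact h'
  rw [siegelTheta, siegelTheta, tsum_mul_tsum_of_summable_norm
    (summable_norm_siegelTheta_term hZim x) (summable_norm_siegelTheta_term hZim y)]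
  have hsum' := (intVecPairEquiv (Fin g)).summable_iff.2 hsum
  rw [← (intVecPairEquiv (Fin g)).tsum_eq]
  refine (hsum'.tsum_prod).trans ?_
  rw [tsum_fintype]
  refine Finset.sum_congr rfl fun a _ => ?_
  refine (hsum'.prod_factor a).tsum_prod.trans ?_
  rw [← tsum_mul_right]
  refine tsum_congr fun m => ?_
  rw [← tsum_mul_left]
  exact tsum_congr fun n => hterm a m n
end

section
/- Let τ be a complex number with Im τ > 0 and let z₁, z₂ ∈ ℂ. Then jacobiTheta₂(z₁, τ) · jacobiTheta₂(z₂, τ) = jacobiTheta₂(z₁ + z₂, 2τ) · jacobiTheta₂(z₁ − z₂, 2τ) + exp(π i (τ + 2 z₁)) · jacobiTheta₂(z₁ + z₂ + τ, 2τ) · jacobiTheta₂(z₁ − z₂ + τ, 2τ). -/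
lemma hasSum_mul_of_hasSum {f g : ℤ → ℂ} {s t : ℂ} (hf : HasSum f s) (hg : HasSum g t) :
    HasSum (fun p : ℤ × ℤ ↦ f p.1 * g p.2) (s * t) :=
  hf.mul hg (summable_mul_of_summable_norm hf.summable.norm hg.summable.norm)

/-- The product of two Jacobi theta functions as a double series over `ℤ × ℤ`. -/
lemma hasSum_jacobiTheta₂_term_mul (z w : ℂ) {τ : ℂ} (hτ : 0 < τ.im) :
    HasSum (fun p : ℤ × ℤ ↦ jacobiTheta₂_term p.1 z τ * jacobiTheta₂_term p.2 w τ)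
      (jacobiTheta₂ z τ * jacobiTheta₂ w τ) :=
  (hasSum_mul_of_hasSum (hasSum_jacobiTheta₂_term z hτ) (hasSum_jacobiTheta₂_term w hτ)).congr_fun
    fun _ ↦ rfl

lemma injective_add_add_sub (c : ℤ) :
    Function.Injective (fun p : ℤ × ℤ ↦ (p.1 + p.2 + c, p.1 - p.2)) := by
  rintro ⟨a, b⟩ ⟨a', b'⟩ h
  simp only [Prod.mk.injEq] at h ⊢
  omega

/-- Pairs of integers split according to whether their entries have the same parity. -/
lemma isCompl_range_add_sub :
    IsCompl (Set.range fun p : ℤ × ℤ ↦ (p.1 + p.2 + 0, p.1 - p.2))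
      (Set.range fun p : ℤ × ℤ ↦ (p.1 + p.2 + 1, p.1 - p.2)) := by
  rw [← compl_eq_iff_isCompl]
  ext ⟨m, n⟩
  simp only [Set.mem_compl_iff, Set.mem_range, Prod.exists, Prod.mk.injEq]
  constructor
  · intro h
    refine ⟨(m + n - 1) / 2, (m - n - 1) / 2, ?_⟩
    have : ¬ ((m + n) / 2 + (m - n) / 2 + 0 = m ∧ (m + n) / 2 - (m - n) / 2 = n) :=
      fun h' ↦ h ⟨_, _, h'⟩
    omega
  · rintro ⟨a, b, h⟩ ⟨a', b', h'⟩
    omega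

/-- A series over `ℤ × ℤ` summed separately over pairs of equal and of different parity. -/
lemma hasSum_of_hasSum_add_sub {f : ℤ × ℤ → ℂ} {s t : ℂ}
    (hs : HasSum (fun p : ℤ × ℤ ↦ f (p.1 + p.2 + 0, p.1 - p.2)) s)
    (ht : HasSum (fun p : ℤ × ℤ ↦ f (p.1 + p.2 + 1, p.1 - p.2)) t) :
    HasSum f (s + t) :=
  HasSum.add_isCompl isCompl_range_add_sub
    ((injective_add_add_sub 0).hasSum_range_iff (f := f).mpr hs)
    ((injective_add_add_sub 1).hasSum_range_iff (f := f).mpr ht)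

open scoped Real
open Complex

theorem jacobiTheta₂_multiplication_formula (τ : ℂ) (hτ : 0 < τ.im) (z₁ z₂ : ℂ) :
    jacobiTheta₂ z₁ τ * jacobiTheta₂ z₂ τ =
      jacobiTheta₂ (z₁ + z₂) (2 * τ) * jacobiTheta₂ (z₁ - z₂) (2 * τ) +
        Complex.exp (↑π * Complex.I * (τ + 2 * z₁)) *
          jacobiTheta₂ (z₁ + z₂ + τ) (2 * τ) * jacobiTheta₂ (z₁ - z₂ + τ) (2 * τ) := by
  have h2τ : 0 < (2 * τ).im := by simpa using hτ
  refine (hasSum_jacobiTheta₂_term_mul z₁ z₂ hτ).unique (hasSum_of_hasSum_add_sub ?_ ?_)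
  · refine (hasSum_jacobiTheta₂_term_mul (z₁ + z₂) (z₁ - z₂) h2τ).congr_fun fun p ↦ ?_
    simp only [jacobiTheta₂_term, ← Complex.exp_add]
    congr 1
    push_cast
    ring
  · rw [mul_assoc]
    have h := (hasSum_jacobiTheta₂_term_mul (z₁ + z₂ + τ) (z₁ - z₂ + τ) h2τ).mul_left
      (Complex.exp (↑π * Complex.I * (τ + 2 * z₁)))
    refine h.congr_fun fun p ↦ ?_
    simp only [jacobiTheta₂_term, ← Complex.exp_add]
    congr 1
    push_cast
    ring
end

section
/- Let G be a finite additive abelian group, let κ be a finite index type, and let M : G → κ → ℂ be a matrix (rows indexed by G) satisfying M(−u) = −M(u) for every u ∈ G. Then 2 · rank(M) ≤ |G| − |{u ∈ G : 2u = 0}|, where the second cardinality is the number of 2-torsion elements (including 0) of G. In particular every row indexed by a 2-torsion element is zero. -/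
/-- In a finite abelian group, one can choose one element from each pair `{u, -u}` with
`u ≠ -u`. -/
theorem exists_finset_half_of_neg (G : Type*) [AddCommGroup G] [Fintype G] [DecidableEq G] :
    ∃ P : Finset G, (∀ u : G, u + u ≠ 0 → u ∈ P ∨ -u ∈ P) ∧
      2 * P.card = Fintype.card G - Fintype.card {u : G // u + u = 0} := by
  let e := Fintype.equivFin G
  let P : Finset G := {u | e u < e (-u)}
  let N : Finset G := {u | e (-u) < e u}
  have hmem (u : G) (hu : u + u ≠ 0) : u ∈ P ∨ u ∈ N := by
    have hne : e u ≠ e (-u) := fun h => hu (eq_neg_iff_add_eq_zero.mp (e.injective h))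
    simpa [P, N] using lt_or_gt_of_ne hne
  have hunion : P ∪ N = {u : G | u + u = 0}ᶜ.toFinset := by
    ext u
    rw [Finset.mem_union, Set.mem_toFinset, Set.mem_compl_iff, Set.mem_ofPred_eq]
    refine ⟨fun h h0 => ?_, hmem u⟩
    simp [P, N, ← eq_neg_iff_add_eq_zero.mpr h0] at h
  have hdisj : Disjoint P N := by
    rw [Finset.disjoint_left]
    intro u hP hN
    simp only [P, N, Finset.mem_filter_univ] at hP hN
    exact lt_asymm hP hN
  have hcard : P.card = N.card :=
    Finset.card_equiv (Equiv.neg G) fun u => by simp [P, N]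
  refine ⟨P, fun u hu => (hmem u hu).imp_right fun h => by simpa [P, N] using h, ?_⟩
  calc 2 * P.card = (P ∪ N).card := by rw [Finset.card_union_of_disjoint hdisj, ← hcard, two_mul]
    _ = Fintype.card {u : G // ¬ u + u = 0} := by
      rw [hunion, Set.toFinset_card]
      exact Fintype.card_congr (Equiv.refl _)
    _ = _ := Fintype.card_subtype_compl _

/-- If the rows indexed by `s` span all rows of a matrix, its rank is at most the size of `s`. -/
theorem Matrix.rank_le_card_of_rows_mem_span {m n K : Type*} [Finite m] [Fintype n] [Field K]
    (A : Matrix m n K) (s : Finset m) (h : ∀ i, A.row i ∈ Submodule.span K (A.row '' s)) :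
    A.rank ≤ s.card := by
  classical
  have hspan : Submodule.span K (Set.range A.row) ≤ Submodule.span K (s.image A.row : Set (n → K)) :=
    Submodule.span_le.mpr <| Set.range_subset_iff.mpr fun i => by
      rw [Finset.coe_image]
      exact h i
  rw [A.rank_eq_finrank_span_row]
  exact (Submodule.finrank_mono hspan).trans
    ((finrank_span_finset_le_card (s.image A.row)).trans Finset.card_image_le)

theorem rank_le_of_odd_rows (G : Type*) [AddCommGroup G] [Fintype G] [DecidableEq G]
    (κ : Type*) [Fintype κ] (M : Matrix G κ ℂ) (hM : ∀ u : G, M (-u) = -M u) :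
    2 * M.rank ≤ Fintype.card G - Fintype.card {u : G // u + u = 0} ∧
      ∀ u : G, u + u = 0 → M u = 0 := by
  have hzero (u : G) (hu : u + u = 0) : M u = 0 := by
    have h := hM u
    rw [← eq_neg_iff_add_eq_zero.mpr hu] at h
    exact self_eq_neg.mp h
  refine ⟨?_, hzero⟩
  obtain ⟨P, hP, hcard⟩ := exists_finset_half_of_neg G
  rw [← hcard]
  refine Nat.mul_le_mul_left 2 (M.rank_le_card_of_rows_mem_span P fun u => ?_)
  change M u ∈ _
  by_cases hu : u + u = 0
  · rw [hzero u hu]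
    exact Submodule.zero_mem _
  · rcases hP u hu with h | h
    · exact Submodule.subset_span ⟨u, h, rfl⟩
    · rw [← neg_neg (M u), ← hM u]
      exact Submodule.neg_mem _ (Submodule.subset_span ⟨-u, h, rfl⟩)
end
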